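/- Let S be a finitary logic, A an S-algebra and X ⊆ A a nonempty subset. Then X is an S-filter of A if and only if the complement A \ X is S-prime. -/

import Mathlib

/-- An algebraic language: a type of function symbols with finite arities. -/
structure Lang where
  F : Type
  ar : F → ℕ

/-- An algebra for the language `L` on the carrier `A`. -/
structure AlgStr (L : Lang) (A : Type) where
  op : ∀ f : L.F, (Fin (L.ar f) → A) → A

/-- Formulas (terms) of `L` over countably many variables. -/
inductive Fm (L : Lang) : Type where
  | var : ℕ → Fm L
  | node : (f : L.F) → (Fin (L.ar f) → Fm L) → Fm L

/-- The absolutely free algebra of formulas (the term algebra). -/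
def FmAlg (L : Lang) : AlgStr L (Fm L) := ⟨Fm.node⟩

/-- Homomorphisms of algebras. -/
def IsHom {L : Lang} {A B : Type} (SA : AlgStr L A) (SB : AlgStr L B) (h : A → B) : Prop :=
  ∀ (f : L.F) (args : Fin (L.ar f) → A), h (SA.op f args) = SB.op f fun i => h (args i)

/-- A logic (deductive system) in the language `L`: a substitution-invariant
consequence relation on formulas. -/
structure Logic (L : Lang) where
  Thm : Set (Fm L) → Fm L → Prop
  refl : ∀ Γ γ, γ ∈ Γ → Thm Γ γ
  cut : ∀ Γ Δ δ, (∀ γ ∈ Γ, Thm Δ γ) → Thm Γ δ → Thm Δ δ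
  subst_inv : ∀ Γ δ (σ : Fm L → Fm L), IsHom (FmAlg L) (FmAlg L) σ →
    Thm Γ δ → Thm (σ '' Γ) (σ δ)

variable {L : Lang} {A : Type}

/-- A logic has theorems when some formula follows from the empty set. -/
def HasTheorems (S : Logic L) : Prop := ∃ δ : Fm L, S.Thm ∅ δ

/-- `S`-filters of an algebra. -/
def IsSFilter (S : Logic L) (SA : AlgStr L A) (F : Set A) : Prop :=
  ∀ h : Fm L → A, IsHom (FmAlg L) SA h →
    ∀ (Γ : Set (Fm L)) (δ : Fm L), S.Thm Γ δ → (∀ γ ∈ Γ, h γ ∈ F) → h δ ∈ F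

/-- The `S`-filter generated by a subset. -/
def Fg (S : Logic L) (SA : AlgStr L A) (B : Set A) : Set A :=
  ⋂₀ {F | IsSFilter S SA F ∧ B ⊆ F}

/-- The specialization quasiorder of an algebra. -/
def SpecLe (S : Logic L) (SA : AlgStr L A) (a b : A) : Prop :=
  Fg S SA {b} ⊆ Fg S SA {a}

/-- Congruences of an algebra. -/
def IsCongr (SA : AlgStr L A) (r : A → A → Prop) : Prop :=
  Equivalence r ∧ ∀ (f : L.F) (x y : Fin (L.ar f) → A),
    (∀ i, r (x i) (y i)) → r (SA.op f x) (SA.op f y)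

/-- A logic is congruential when the specialization equivalence is a congruence
of every algebra. -/
def Congruential (S : Logic L) : Prop :=
  ∀ (A : Type) (SA : AlgStr L A),
    IsCongr SA fun a b => SpecLe S SA a b ∧ SpecLe S SA b a

/-- `S`-algebras: the identity is the only congruence below the specialization
equivalence. -/
def IsSAlgebra (S : Logic L) (SA : AlgStr L A) : Prop :=
  ∀ r : A → A → Prop, IsCongr SA r →
    (∀ a b, r a b → SpecLe S SA a b ∧ SpecLe S SA b a) → ∀ a b, r a b → a = b

/-- Finitary logics. -/
def Finitary (S : Logic L) : Prop :=
  ∀ (Γ : Set (Fm L)) (δ : Fm L), S.Thm Γ δ →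
    ∃ Γ₀ : Finset (Fm L), ↑Γ₀ ⊆ Γ ∧ S.Thm ↑Γ₀ δ

/-- Filter-distributive logics: the lattice of `S`-filters of every algebra is
distributive. -/
def FilterDistributive (S : Logic L) : Prop :=
  ∀ (A : Type) (SA : AlgStr L A) (F G H : Set A),
    IsSFilter S SA F → IsSFilter S SA G → IsSFilter S SA H →
      F ∩ Fg S SA (G ∪ H) = Fg S SA ((F ∩ G) ∪ (F ∩ H))

/-- `S`-ideals. -/
def IsSIdeal (S : Logic L) (SA : AlgStr L A) (I : Set A) : Prop :=
  ∀ I' : Finset A, ↑I' ⊆ I → ∀ a : A,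
    (⋂ b ∈ I', Fg S SA {b}) ⊆ Fg S SA {a} → a ∈ I

/-- The strong-ideal condition. -/
def StrongIdealCond (S : Logic L) (SA : AlgStr L A) (I : Set A) : Prop :=
  ∀ I' : Finset A, ↑I' ⊆ I → ∀ B : Finset A, B.Nonempty →
    (⋂ b ∈ I', Fg S SA {b}) ⊆ Fg S SA ↑B → (Fg S SA ↑B ∩ I).Nonempty

/-- Strong `S`-ideals. -/
def IsStrongSIdeal (S : Logic L) (SA : AlgStr L A) (I : Set A) : Prop :=
  IsSIdeal S SA I ∧ StrongIdealCond S SA I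

/-- Optimal `S`-filters. -/
def IsOptimalSFilter (S : Logic L) (SA : AlgStr L A) (F : Set A) : Prop :=
  IsSFilter S SA F ∧ ∃ I : Set A, IsStrongSIdeal S SA I ∧ F ∩ I = ∅ ∧
    (∀ G, IsSFilter S SA G → G ∩ I = ∅ → F ⊆ G → G = F) ∧
    (∀ J, IsStrongSIdeal S SA J → F ∩ J = ∅ → I ⊆ J → J = I)

/-- Irreducible `S`-filters: meet-irreducible elements of the lattice of
`S`-filters. -/
def IsIrrSFilter (S : Logic L) (SA : AlgStr L A) (F : Set A) : Prop :=
  IsSFilter S SA F ∧ F ≠ Set.univ ∧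
    ∀ G H, IsSFilter S SA G → IsSFilter S SA H → F = G ∩ H → F = G ∨ F = H

/-- Order ideals of the poset `(A, ≤)` given by the specialization order. -/
def IsSpecOrderIdeal (S : Logic L) (SA : AlgStr L A) (I : Set A) : Prop :=
  I.Nonempty ∧ (∀ a ∈ I, ∀ b, SpecLe S SA b a → b ∈ I) ∧ DirectedOn (SpecLe S SA) I

/-- Bottom families. -/
def IsBottomFamily (S : Logic L) (SA : AlgStr L A) (U : Finset A) : Prop :=
  U.Nonempty ∧ (∀ a ∈ U, ∀ b ∈ U, a ≠ b → ¬ SpecLe S SA a b) ∧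
    Fg S SA ↑U = Set.univ

/-- `S`-prime subsets. -/
def IsSPrime (S : Logic L) (SA : AlgStr L A) (X : Set A) : Prop :=
  X ≠ Set.univ ∧ ∀ B : Finset A, B.Nonempty →
    (Fg S SA ↑B ∩ X).Nonempty → ((↑B : Set A) ∩ X).Nonempty

/-- Closure bases for the system of `S`-filters. -/
def IsClosureBase (S : Logic L) (SA : AlgStr L A) (𝓕 : Set (Set A)) : Prop :=
  (∀ P ∈ 𝓕, IsSFilter S SA P) ∧
    ∀ F, IsSFilter S SA F → F = ⋂₀ {P | P ∈ 𝓕 ∧ F ⊆ P}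

/-- The representation map `φ` relative to a closure base. -/
def Phi (𝓕 : Set (Set A)) (a : A) : Set (Set A) := {P | P ∈ 𝓕 ∧ a ∈ P}

/-- The extension `φ̂` of the representation map to subsets. -/
def PhiHat (𝓕 : Set (Set A)) (B : Set A) : Set (Set A) := {P | P ∈ 𝓕 ∧ B ⊆ P}

/-- The carrier of the `S`-semilattice `M(A)` relative to a closure base. -/
def MSet (𝓕 : Set (Set A)) : Set (Set (Set A)) :=
  {U | ∃ B : Finset A, U = PhiHat 𝓕 ↑B}

/-- Filters of the meet-semilattice with carrier `MA` (ordered by inclusion,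
with meet the binary intersection). -/
def IsMFilter (MA G : Set (Set (Set A))) : Prop :=
  G ⊆ MA ∧ G.Nonempty ∧ (∀ U ∈ G, ∀ V ∈ MA, U ⊆ V → V ∈ G) ∧
    ∀ U ∈ G, ∀ V ∈ G, U ∩ V ∈ G

/-- The filter of the meet-semilattice `MA` generated by a subset. -/
def MGen (MA X : Set (Set (Set A))) : Set (Set (Set A)) :=
  ⋂₀ {G | IsMFilter MA G ∧ X ⊆ G}

/-- Frink ideals of the meet-semilattice with carrier `MA`. -/
def IsMFrinkIdeal (MA J : Set (Set (Set A))) : Prop :=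
  J ⊆ MA ∧ ∀ J' : Finset (Set (Set A)), ↑J' ⊆ J → ∀ b ∈ MA,
    (∀ c ∈ MA, (∀ a ∈ J', a ⊆ c) → b ⊆ c) → b ∈ J

/-- The Frink ideal of the meet-semilattice `MA` generated by a subset. -/
def MFrinkGen (MA X : Set (Set (Set A))) : Set (Set (Set A)) :=
  ⋂₀ {J | IsMFrinkIdeal MA J ∧ X ⊆ J}

/-- `∧`-prime subsets of the meet-semilattice with carrier `MA`. -/
def IsMPrime (MA X : Set (Set (Set A))) : Prop :=
  X ⊆ MA ∧ X ≠ MA ∧ ∀ U : Finset (Set (Set A)), U.Nonempty → ↑U ⊆ MA →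
    ⋂₀ ↑U ∈ X → ∃ u ∈ U, u ∈ X

/-- Optimal filters of the meet-semilattice with carrier `MA`. -/
def IsMOptFilter (MA F : Set (Set (Set A))) : Prop :=
  IsMFilter MA F ∧ ∃ I, IsMFrinkIdeal MA I ∧ F ∩ I = ∅ ∧
    (∀ G, IsMFilter MA G → G ∩ I = ∅ → F ⊆ G → G = F) ∧
    (∀ J, IsMFrinkIdeal MA J → F ∩ J = ∅ → I ⊆ J → J = I)

theorem subset_Fg (S : Logic L) (SA : AlgStr L A) (B : Set A) : B ⊆ Fg S SA B :=
  Set.subset_sInter fun _ hF => hF.2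

theorem Fg_subset {S : Logic L} {SA : AlgStr L A} {B F : Set A}
    (hF : IsSFilter S SA F) (hB : B ⊆ F) : Fg S SA B ⊆ F :=
  Set.sInter_subset_of_mem ⟨hF, hB⟩

theorem isSFilter_Fg (S : Logic L) (SA : AlgStr L A) (B : Set A) :
    IsSFilter S SA (Fg S SA B) := fun h hh Γ δ hΓ hmem F hF =>
  hF.1 h hh Γ δ hΓ fun γ hγ => hmem γ hγ F hF

/-- For a finitary logic and an `S`-algebra, a nonempty subset is an `S`-filter
iff its complement is `S`-prime. -/
theorem filter_iff_compl_sprime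
    {L : Lang} (S : Logic L) {A : Type} (SA : AlgStr L A)
    (hfin : Finitary S) (halg : IsSAlgebra S SA)
    (X : Set A) (hX : X.Nonempty) :
    IsSFilter S SA X ↔ IsSPrime S SA Xᶜ := by
  classical
  constructor
  · refine fun hF => ⟨fun h => ?_, fun B _ ⟨a, ha, haX⟩ => ?_⟩
    · rw [Set.compl_univ_iff] at h
      exact hX.ne_empty h
    · by_contra hBX
      refine haX (Fg_subset hF (fun b hb => ?_) ha)
      by_contra hbX
      exact hBX ⟨b, hb, hbX⟩
  · intro hprime h hh Γ δ hΓ hmem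
    obtain ⟨Γ₀, hsub, hΓ₀⟩ := hfin Γ δ hΓ
    obtain ⟨x, hx⟩ := hX
    by_contra hδ
    have hgen : h δ ∈ Fg S SA ↑(insert x (Γ₀.image h)) :=
      isSFilter_Fg S SA _ h hh Γ₀ δ hΓ₀ fun γ hγ =>
        subset_Fg S SA _ (Finset.mem_coe.2
          (Finset.mem_insert_of_mem (Finset.mem_image_of_mem h (Finset.mem_coe.1 hγ))))
    obtain ⟨b, hb, hbX⟩ := hprime.2 _ (Finset.insert_nonempty x _) ⟨h δ, hgen, hδ⟩
    rcases Finset.mem_insert.1 (Finset.mem_coe.1 hb) with rfl | hb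
    · exact hbX hx
    · obtain ⟨γ, hγ, rfl⟩ := Finset.mem_image.1 hb
      exact hbX (hmem γ (hsub (Finset.mem_coe.2 hγ)))
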